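/- Let (Ω, μ) be a finite probability space, and let Y : Ω → Bool and Ŷ : Ω → Bool be random variables. Let e = μ{ω | Y(ω) ≠ Ŷ(ω)} be the error probability. Then the conditional Shannon entropy satisfies H(Y | Ŷ) ≤ h(e), where h is the binary entropy function. (Binary Fano inequality.) -/

import Mathlib

open MeasureTheory ProbabilityTheory

/-- Shannon entropy (natural log) of a `Bool`-valued random variable on a
finite probability space. -/
noncomputable def boolEntropy {Ω : Type*} [Fintype Ω] [MeasurableSpace Ω]
    (μ : Measure Ω) (X : Ω → Bool) : ℝ :=
  ∑ x : Bool, Real.negMulLog ((μ {ω | X ω = x}).toReal)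

/-- Conditional Shannon entropy `H(X | Z)` of `Bool`-valued random variables:
`H(X | Z) = Σ_z μ(Z = z) · H(X | Z = z)`, where `H(X | Z = z)` is the entropy
of `X` under the conditional measure `μ[|Z = z]`. -/
noncomputable def boolCondEntropy {Ω : Type*} [Fintype Ω] [MeasurableSpace Ω]
    (μ : Measure Ω) (X Z : Ω → Bool) : ℝ :=
  ∑ z : Bool, (μ {ω | Z ω = z}).toReal * boolEntropy (μ[|{ω | Z ω = z}]) X

/-- The entropy of a `Bool`-valued random variable is the binary entropy of the probability
that it avoids a given value. -/
theorem boolEntropy_eq_binEntropy {Ω : Type*} [Fintype Ω] [MeasurableSpace Ω]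
    [MeasurableSingletonClass Ω] (μ : Measure Ω) [IsProbabilityMeasure μ]
    (X : Ω → Bool) (b : Bool) :
    boolEntropy μ X = Real.binEntropy (μ {ω | X ω ≠ b}).toReal := by
  have hcompl : (μ {ω | X ω ≠ b}).toReal = 1 - (μ {ω | X ω = b}).toReal :=
    probReal_compl_eq_one_sub (μ := μ) (s := {ω | X ω = b}) (Set.toFinite _).measurableSet
  have hnot : {ω | X ω ≠ b} = {ω | X ω = !b} := by
    ext ω
    exact Bool.eq_not.symm
  rw [Real.binEntropy_eq_negMulLog_add_negMulLog_one_sub, hcompl, sub_sub_cancel, ← hcompl, hnot]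
  cases b <;> simp [boolEntropy, add_comm]

/-- The total probability formula for the error event of a `Bool`-valued predictor. -/
theorem sum_mul_cond_ne {Ω : Type*} [Fintype Ω] [MeasurableSpace Ω]
    [MeasurableSingletonClass Ω] (μ : Measure Ω) [IsFiniteMeasure μ] (Y Z : Ω → Bool) :
    ∑ z : Bool, (μ {ω | Z ω = z}).toReal * ((μ[|{ω | Z ω = z}]) {ω | Y ω ≠ z}).toReal =
      (μ {ω | Y ω ≠ Z ω}).toReal := by
  have hterm (z : Bool) :
      (μ {ω | Z ω = z}).toReal * ((μ[|{ω | Z ω = z}]) {ω | Y ω ≠ z}).toReal =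
        (μ ({ω | Y ω ≠ Z ω} ∩ {ω | Z ω = z})).toReal := by
    rw [← ENNReal.toReal_mul, mul_comm, cond_mul_eq_inter (Set.toFinite _).measurableSet]
    congr 2
    ext ω
    simp only [Set.mem_inter_iff, Set.mem_ofPred_eq]
    grind
  have hcompl : {ω | Z ω = false} = {ω | Z ω = true}ᶜ := by
    ext ω
    simp
  simp only [hterm, Fintype.sum_bool]
  rw [hcompl, ← Set.sdiff_eq]
  exact measureReal_inter_add_sdiff (μ := μ) (Set.toFinite {ω | Z ω = true}).measurableSet

/-- **Binary Fano inequality.** On a finite probability space, if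
`e = μ{Y ≠ Ŷ}` is the error probability of the predictor `Ŷ` of `Y`, then
`H(Y | Ŷ) ≤ h(e)` where `h` is the binary entropy function. -/
theorem binary_fano {Ω : Type*} [Fintype Ω] [MeasurableSpace Ω]
    [MeasurableSingletonClass Ω] (μ : Measure Ω) [IsProbabilityMeasure μ]
    (Y Yhat : Ω → Bool) :
    boolCondEntropy μ Y Yhat ≤ Real.binEntropy (μ {ω | Y ω ≠ Yhat ω}).toReal := by
  have hterm (z : Bool) :
      (μ {ω | Yhat ω = z}).toReal * boolEntropy (μ[|{ω | Yhat ω = z}]) Y =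
        (μ {ω | Yhat ω = z}).toReal *
          Real.binEntropy ((μ[|{ω | Yhat ω = z}]) {ω | Y ω ≠ z}).toReal := by
    by_cases hz : μ {ω | Yhat ω = z} = 0
    · simp [hz]
    · have := cond_isProbabilityMeasure hz
      rw [boolEntropy_eq_binEntropy _ Y z]
  have hweights : ∑ z : Bool, (μ {ω | Yhat ω = z}).toReal = 1 := by
    have hcompl : {ω | Yhat ω = false} = {ω | Yhat ω = true}ᶜ := by
      ext ω
      simp
    rw [Fintype.sum_bool, hcompl]
    exact probReal_add_probReal_compl (μ := μ) (Set.toFinite {ω | Yhat ω = true}).measurableSet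
  have hjensen := Real.strictConcave_binEntropy.concaveOn.le_map_sum
    (t := Finset.univ) (w := fun z : Bool => (μ {ω | Yhat ω = z}).toReal)
    (p := fun z => ((μ[|{ω | Yhat ω = z}]) {ω | Y ω ≠ z}).toReal)
    (fun _ _ => ENNReal.toReal_nonneg) hweights
    (fun _ _ => ⟨ENNReal.toReal_nonneg, measureReal_le_one⟩)
  simp only [smul_eq_mul, sum_mul_cond_ne] at hjensen
  simpa only [boolCondEntropy, hterm] using hjensen
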